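/- arXiv:1606.02291 — 2 statements merged into one kernel-verified Lean document; each statement's English description precedes it below -/
import Mathlib

section
/- For every index i with i + 2 < n and every f ∈ R, the braid relations hold: ∂_i (∂_{i+1} (∂_i f)) = ∂_{i+1} (∂_i (∂_{i+1} f)), π_i (π_{i+1} (π_i f)) = π_{i+1} (π_i (π_{i+1} f)), and θ_i (θ_{i+1} (θ_i f)) = θ_{i+1} (θ_i (θ_{i+1} f)). -/
open MvPolynomial

noncomputable section

/-- Valid indices: `i` with `i + 1 < n`. -/
abbrev Idx (n : ℕ) := {i : ℕ // i + 1 < n}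

/-- The element `i` of `Fin n`. -/
def idxLow {n : ℕ} (i : Idx n) : Fin n := ⟨i.1, Nat.lt_of_succ_lt i.2⟩

/-- The element `i + 1` of `Fin n`. -/
def idxHigh {n : ℕ} (i : Idx n) : Fin n := ⟨i.1 + 1, i.2⟩

/-- The simple transposition `s_i = (i, i+1)` in `S_n`. -/
def simpleT {n : ℕ} (i : Idx n) : Equiv.Perm (Fin n) := Equiv.swap (idxLow i) (idxHigh i)

/-- The action of `s_i` on polynomials, renaming the variables `X i` and `X (i+1)`. -/
def sOp {n : ℕ} (i : Idx n) (f : MvPolynomial (Fin n) ℤ) : MvPolynomial (Fin n) ℤ :=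
  rename ⇑(simpleT i) f

/-- The type of families of operators indexed by valid indices. -/
abbrev DD (n : ℕ) := Idx n → MvPolynomial (Fin n) ℤ → MvPolynomial (Fin n) ℤ

/-- `D` is the family of divided difference operators `∂_i`:
`(X i − X (i+1)) * ∂_i f = f − s_i f` (this determines `∂_i f` uniquely since
`MvPolynomial (Fin n) ℤ` is an integral domain). -/
def IsDividedDiff {n : ℕ} (D : DD n) : Prop :=
  ∀ (i : Idx n) (f : MvPolynomial (Fin n) ℤ),
    (X (idxLow i) - X (idxHigh i)) * D i f = f - sOp i f

/-- `π_i f = ∂_i (X i * f)`. -/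
def piOp {n : ℕ} (D : DD n) (i : Idx n) (f : MvPolynomial (Fin n) ℤ) :
    MvPolynomial (Fin n) ℤ :=
  D i (X (idxLow i) * f)

/-- `θ_i f = X (i+1) * ∂_i f`. -/
def thetaOp {n : ℕ} (D : DD n) (i : Idx n) (f : MvPolynomial (Fin n) ℤ) :
    MvPolynomial (Fin n) ℤ :=
  X (idxHigh i) * D i f

/-- `θ_w = θ_{i_1} ∘ ⋯ ∘ θ_{i_k}` for a word `w = (i_1, …, i_k)`. -/
def thetaWord {n : ℕ} (D : DD n) : List (Idx n) → MvPolynomial (Fin n) ℤ → MvPolynomial (Fin n) ℤ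
  | [], f => f
  | i :: w, f => thetaOp D i (thetaWord D w f)

/-- `π_w = π_{i_1} ∘ ⋯ ∘ π_{i_k}` for a word `w = (i_1, …, i_k)`. -/
def piWord {n : ℕ} (D : DD n) : List (Idx n) → MvPolynomial (Fin n) ℤ → MvPolynomial (Fin n) ℤ
  | [], f => f
  | i :: w, f => piOp D i (piWord D w f)

/-- The permutation `s_{i_1} · ⋯ · s_{i_k}` represented by a word. -/
def wordProd {n : ℕ} (w : List (Idx n)) : Equiv.Perm (Fin n) := (w.map simpleT).prod

/-- `w` is a reduced word for `σ`: it represents `σ` and no shorter word does. -/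
def IsReducedWord {n : ℕ} (w : List (Idx n)) (σ : Equiv.Perm (Fin n)) : Prop :=
  wordProd w = σ ∧ ∀ w' : List (Idx n), wordProd w' = σ → w.length ≤ w'.length

/-- The length `l(σ)`: the length of any reduced word for `σ`. -/
def len {n : ℕ} (σ : Equiv.Perm (Fin n)) : ℕ :=
  sInf {k | ∃ w : List (Idx n), wordProd w = σ ∧ w.length = k}

/-- Strong Bruhat order: some reduced word of `γ` is a (not necessarily contiguous)
subword of some reduced word of `σ`. -/
def BruhatLE {n : ℕ} (γ σ : Equiv.Perm (Fin n)) : Prop :=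
  ∃ u v : List (Idx n), IsReducedWord u γ ∧ IsReducedWord v σ ∧ u.Sublist v

/-- The monomial `x^λ = ∏ j, (X j)^(λ j)`. -/
def xpow {n : ℕ} (lam : Fin n → ℕ) : MvPolynomial (Fin n) ℤ := ∏ j, X j ^ lam j

/-- `f` is atom-positive: it lies in the additive submonoid generated by the
Demazure atoms `θ_w (x^λ)` with `w` a reduced word and `λ` a partition. -/
def AtomPos {n : ℕ} (D : DD n) (f : MvPolynomial (Fin n) ℤ) : Prop :=
  f ∈ AddSubmonoid.closure {g : MvPolynomial (Fin n) ℤ |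
    ∃ (w : List (Idx n)) (σ : Equiv.Perm (Fin n)) (lam : Fin n → ℕ),
      IsReducedWord w σ ∧ Antitone lam ∧ g = thetaWord D w (xpow lam)}

/-- `f` is key-positive: it lies in the additive submonoid generated by the
key polynomials `π_w (x^λ)` with `w` a word and `λ` a partition. -/
def KeyPos {n : ℕ} (D : DD n) (f : MvPolynomial (Fin n) ℤ) : Prop :=
  f ∈ AddSubmonoid.closure {g : MvPolynomial (Fin n) ℤ |
    ∃ (w : List (Idx n)) (lam : Fin n → ℕ),
      Antitone lam ∧ g = piWord D w (xpow lam)}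

/-- The number of inversions of a permutation. -/
def invNum {n : ℕ} (σ : Equiv.Perm (Fin n)) : ℕ :=
  (Finset.univ.filter (fun p : Fin n × Fin n => p.1 < p.2 ∧ σ p.2 < σ p.1)).card

end

/-- The expansion of `P (Q (P f))` in terms of the six images of `f` under the group generated by
`s` and `t`, for twisted divided differences `P f = (u a b * f - v a b * s f) / (a - b)` and
`Q f = (u b c * f - v b c * t f) / (b - c)`. -/
lemma twistedDividedDiff_triple {R : Type*} [CommRing R] (s t : R →+* R) (a b c : R)
    (hs : ∀ g, s (s g) = g) (hsa : s a = b) (hsb : s b = a) (hsc : s c = c)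
    (hta : t a = a) (htb : t b = c)
    (u v : R → R → R)
    (hsu : ∀ x y, s (u x y) = u (s x) (s y)) (hsv : ∀ x y, s (v x y) = v (s x) (s y))
    (htu : ∀ x y, t (u x y) = u (t x) (t y)) (htv : ∀ x y, t (v x y) = v (t x) (t y))
    (P Q : R → R) (hP : ∀ g, (a - b) * P g = u a b * g - v a b * s g)
    (hQ : ∀ g, (b - c) * Q g = u b c * g - v b c * t g) (f : R) :
    (a - b) ^ 2 * (b - c) * (a - c) * P (Q (P f)) =
      u a b * u b c * (a - c) * (u a b * f - v a b * s f)
      - u a b * v b c * (a - b) * (u a c * t f - v a c * t (s f))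
      + v a b * u a c * (b - c) * (u b a * s f - v b a * f)
      + v a b * v a c * (a - b) * (u b c * s (t f) - v b c * s (t (s f))) := by
  have hF := hP f
  have hG := hQ (P f)
  have hH := hP (Q (P f))
  have htF := congrArg t hF
  have hsF := congrArg s hF
  have hsG := congrArg s hG
  have hstF := congrArg s htF
  simp only [map_sub, map_mul, hs, hsa, hsb, hsc, hta, htb, hsu, hsv, htu, htv]
    at htF hsF hsG hstF
  linear_combination (a - b) * (b - c) * (a - c) * hH + u a b * (a - b) * (a - c) * hG
    + u a b * u b c * (a - c) * hF - u a b * v b c * (a - b) * htF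
    - v a b * (a - b) * (b - c) * hsG + v a b * u a c * (b - c) * hsF
    + v a b * v a c * (a - b) * hstF

/-- Twisted divided differences attached to `s` and `t` satisfy the braid relation for the
twists `(u, v)` equal to `(1, 1)`, `(x, y)` or `(y, y)`. -/
lemma twistedDividedDiff_braid {R : Type*} [CommRing R] [IsDomain R] (s t : R →+* R) (a b c : R)
    (hab : a ≠ b) (hbc : b ≠ c) (hac : a ≠ c)
    (hs : ∀ g, s (s g) = g) (hsa : s a = b) (hsb : s b = a) (hsc : s c = c)
    (ht : ∀ g, t (t g) = g) (hta : t a = a) (htb : t b = c) (htc : t c = b)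
    (hst : ∀ g, s (t (s g)) = t (s (t g)))
    (u v : R → R → R)
    (hsu : ∀ x y, s (u x y) = u (s x) (s y)) (hsv : ∀ x y, s (v x y) = v (s x) (s y))
    (htu : ∀ x y, t (u x y) = u (t x) (t y)) (htv : ∀ x y, t (v x y) = v (t x) (t y))
    (P Q : R → R) (hP : ∀ g, (a - b) * P g = u a b * g - v a b * s g)
    (hQ : ∀ g, (b - c) * Q g = u b c * g - v b c * t g)
    (huv : (∀ x y, u x y = 1 ∧ v x y = 1) ∨ (∀ x y, u x y = x ∧ v x y = y) ∨
      (∀ x y, u x y = y ∧ v x y = y)) (f : R) :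
    P (Q (P f)) = Q (P (Q f)) := by
  have hL := twistedDividedDiff_triple s t a b c hs hsa hsb hsc hta htb u v hsu hsv htu htv
    P Q hP hQ f
  have hR := twistedDividedDiff_triple t s c b a ht htc htb hta hsc hsb
    (fun x y => -u y x) (fun x y => -v y x)
    (by simp [htu]) (by simp [htv]) (by simp [hsu]) (by simp [hsv]) Q P
    (fun g => by linear_combination -hQ g) (fun g => by linear_combination -hP g) f
  rw [← hst] at hR
  have hne : (a - b) ^ 2 * (b - c) ^ 2 * (a - c) ≠ 0 :=
    mul_ne_zero (mul_ne_zero (pow_ne_zero 2 (sub_ne_zero.2 hab))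
      (pow_ne_zero 2 (sub_ne_zero.2 hbc))) (sub_ne_zero.2 hac)
  refine mul_left_cancel₀ hne ?_
  rcases huv with h | h | h <;>
  · simp only [fun x y => (h x y).1, fun x y => (h x y).2] at hL hR
    linear_combination (b - c) * hL - (a - b) * hR

/-- braid relations for `∂`, `π`, `θ`. -/
theorem stmt5 (n : ℕ) (D : DD n) (hD : IsDividedDiff D) (i : ℕ)
    (h1 : i + 1 < n) (h2 : i + 1 + 1 < n) (f : MvPolynomial (Fin n) ℤ) :
    D ⟨i, h1⟩ (D ⟨i + 1, h2⟩ (D ⟨i, h1⟩ f)) =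
      D ⟨i + 1, h2⟩ (D ⟨i, h1⟩ (D ⟨i + 1, h2⟩ f)) ∧
    piOp D ⟨i, h1⟩ (piOp D ⟨i + 1, h2⟩ (piOp D ⟨i, h1⟩ f)) =
      piOp D ⟨i + 1, h2⟩ (piOp D ⟨i, h1⟩ (piOp D ⟨i + 1, h2⟩ f)) ∧
    thetaOp D ⟨i, h1⟩ (thetaOp D ⟨i + 1, h2⟩ (thetaOp D ⟨i, h1⟩ f)) =
      thetaOp D ⟨i + 1, h2⟩ (thetaOp D ⟨i, h1⟩ (thetaOp D ⟨i + 1, h2⟩ f)) := by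
  set p : Idx n := ⟨i, h1⟩
  set q : Idx n := ⟨i + 1, h2⟩
  have hqp : idxLow q = idxHigh p := rfl
  have hlm : idxLow p ≠ idxHigh p := by simp [idxLow, idxHigh, p]
  have hmh : idxHigh p ≠ idxHigh q := by simp [idxHigh, p, q]
  have hlh : idxLow p ≠ idxHigh q := by
    simp only [idxLow, idxHigh, p, q, ne_eq, Fin.mk.injEq]
    omega
  have hX {j k : Fin n} (h : j ≠ k) : (X j : MvPolynomial (Fin n) ℤ) ≠ X k :=
    fun e => h (X_injective e)
  let S (r : Idx n) : MvPolynomial (Fin n) ℤ →+* MvPolynomial (Fin n) ℤ :=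
    (rename (simpleT r)).toRingHom
  have hSX (r : Idx n) (j : Fin n) : S r (X j) = X (simpleT r j) := rename_X _ _
  have hSS (r : Idx n) (g) : S r (S r g) = g := by
    change rename _ (rename _ g) = g
    rw [rename_rename]
    have : ⇑(simpleT r) ∘ ⇑(simpleT r) = id := funext fun j => Equiv.swap_apply_self _ _ j
    rw [this, rename_id_apply]
  have hST (g) : S p (S q (S p g)) = S q (S p (S q g)) := by
    change rename _ (rename _ (rename _ g)) = rename _ (rename _ (rename _ g))
    simp only [rename_rename]
    congr 2
    funext j
    simp only [Function.comp_apply, simpleT, hqp, Equiv.swap_apply_def]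
    grind
  have hD' (r : Idx n) (g) : (X (idxLow r) - X (idxHigh r)) * D r g = g - S r g := hD r g
  have braid := twistedDividedDiff_braid (S p) (S q) (X (idxLow p)) (X (idxHigh p))
    (X (idxHigh q)) (hX hlm) (hX hmh) (hX hlh) (hSS p)
    (by rw [hSX, simpleT, Equiv.swap_apply_left]) (by rw [hSX, simpleT, Equiv.swap_apply_right])
    (by rw [hSX, simpleT, Equiv.swap_apply_of_ne_of_ne hlh.symm hmh.symm]) (hSS q)
    (by rw [hSX, simpleT, Equiv.swap_apply_of_ne_of_ne (hqp ▸ hlm) hlh])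
    (by rw [hSX, simpleT, hqp, Equiv.swap_apply_left])
    (by rw [hSX, simpleT, hqp, Equiv.swap_apply_right]) hST
  have hpi (r : Idx n) (g) : (X (idxLow r) - X (idxHigh r)) * piOp D r g =
      X (idxLow r) * g - X (idxHigh r) * S r g := by
    rw [piOp, hD', map_mul, hSX, simpleT, Equiv.swap_apply_left]
  have htheta (r : Idx n) (g) : (X (idxLow r) - X (idxHigh r)) * thetaOp D r g =
      X (idxHigh r) * g - X (idxHigh r) * S r g := by
    rw [thetaOp]
    linear_combination X (idxHigh r) * hD' r g
  refine ⟨?_, ?_, ?_⟩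
  · exact braid (fun _ _ => 1) (fun _ _ => 1) (by simp) (by simp) (by simp) (by simp) (D p) (D q)
      (by simpa using hD' p) (by simpa [hqp] using hD' q) (by simp) f
  · exact braid (fun x _ => x) (fun _ y => y) (by simp) (by simp) (by simp) (by simp)
      (piOp D p) (piOp D q) (hpi p) (hpi q) (by simp) f
  · exact braid (fun _ y => y) (fun _ y => y) (by simp) (by simp) (by simp) (by simp)
      (thetaOp D p) (thetaOp D q) (htheta p) (htheta q) (by simp) f
end

section
/- Let γ ∈ S_n, let (i_1, …, i_k) be a reduced word for γ, and let i be an index with i + 1 < n. If l(s_i · γ) = l(γ) − 1, then θ_i (θ_{(i_1,…,i_k)} f) = −θ_{(i_1,…,i_k)} f for every f ∈ R; if instead l(s_i · γ) = l(γ) + 1, then (i, i_1, …, i_k) is a reduced word for s_i · γ (so θ_i ∘ θ_γ = θ_{s_i γ}). -/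
open MvPolynomial

section Operators

variable {A : Type*} [CommRing A] [IsDomain A]

theorem demazure_quadratic {s : A →+* A} {a b : A} {T : A → A} (hab : a - b ≠ 0)
    (hsa : s a = b) (hsb : s b = a) (hss : ∀ f, s (s f) = f)
    (hT : ∀ f, (a - b) * T f = b * (f - s f)) (f : A) : T (T f) = - T f := by
  have h1 := hT f
  have h2 := hT (T f)
  have h3 := congrArg s h1
  simp only [map_mul, map_sub, hsa, hsb, hss] at h3
  refine mul_left_cancel₀ (mul_ne_zero hab hab) ?_
  linear_combination (a - b) * h2 + a * h1 + b * h3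

theorem demazure_commute {s t : A →+* A} {a b c d : A} {S T : A → A} (hab : a - b ≠ 0)
    (hcd : c - d ≠ 0) (hsc : s c = c) (hsd : s d = d) (hta : t a = a) (htb : t b = b)
    (hst : ∀ f, s (t f) = t (s f)) (hS : ∀ f, (a - b) * S f = b * (f - s f))
    (hT : ∀ f, (c - d) * T f = d * (f - t f)) (f : A) : S (T f) = T (S f) := by
  have h1 := hS f
  have h2 := hT f
  have h3 := congrArg t h1
  have h4 := congrArg s h2
  simp only [map_mul, map_sub, hsc, hsd, hta, htb, hst] at h3 h4
  refine mul_left_cancel₀ (mul_ne_zero hab hcd) ?_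
  linear_combination (c - d) * hS (T f) - (a - b) * hT (S f) + b * h2 - b * h4 - d * h1 + d * h3

theorem demazure_braid {s t : A →+* A} {a b c : A} {S T : A → A} (hab : a - b ≠ 0)
    (hbc : b - c ≠ 0) (hac : a - c ≠ 0) (hsa : s a = b) (hsb : s b = a) (hsc : s c = c)
    (hta : t a = a) (htb : t b = c) (htc : t c = b)
    (hss : ∀ f, s (s f) = f) (htt : ∀ f, t (t f) = f)
    (hst : ∀ f, s (t (s f)) = t (s (t f))) (hS : ∀ f, (a - b) * S f = b * (f - s f))
    (hT : ∀ f, (b - c) * T f = c * (f - t f)) (f : A) : S (T (S f)) = T (S (T f)) := by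
  have g := hS f
  have h := hT (S f)
  have k := hS (T (S f))
  have g1 := congrArg s g
  have g2 := congrArg t g
  have g12 := congrArg s g2
  have h1 := congrArg s h
  have g' := hT f
  have h' := hS (T f)
  have k' := hT (S (T f))
  have g1' := congrArg s g'
  have g2' := congrArg t g'
  have g21' := congrArg t g1'
  have h2' := congrArg t h'
  simp only [map_mul, map_sub, hsa, hsb, hsc, hta, htb, htc, hss, htt, hst] at *
  refine mul_left_cancel₀ (mul_ne_zero (mul_ne_zero (mul_ne_zero hab hab) (mul_ne_zero hbc hbc))
    hac) ?_
  linear_combination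
    (b - c) * ((a - b) * (b - c) * (a - c) * k + b * (a - b) * (a - c) * h
      - b * (a - b) * (b - c) * h1 + b * c * (a - c) * g - b * c * (a - b) * g2
      + b * c * (b - c) * g1 + b * c * (a - b) * g12)
    - (a - b) * ((b - c) * (a - b) * (a - c) * k' + c * (b - c) * (a - c) * h'
      - c * (a - b) * (b - c) * h2' + c * b * (a - c) * g' - c * b * (b - c) * g1'
      + c * c * (a - b) * g2' + c * c * (b - c) * g21')

end Operators

section SimpleTranspositions

variable {n : ℕ}

theorem idxLow_lt_idxHigh (i : Idx n) : idxLow i < idxHigh i := by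
  simp [idxLow, idxHigh]

theorem simpleT_mul_self (i : Idx n) : simpleT i * simpleT i = 1 :=
  Equiv.swap_mul_self _ _

theorem simpleT_inv (i : Idx n) : (simpleT i)⁻¹ = simpleT i :=
  Equiv.swap_inv _ _

theorem simpleT_idxLow (i : Idx n) : simpleT i (idxLow i) = idxHigh i :=
  Equiv.swap_apply_left _ _

theorem simpleT_idxHigh (i : Idx n) : simpleT i (idxHigh i) = idxLow i :=
  Equiv.swap_apply_right _ _

theorem simpleT_idxLow_of_far {i j : Idx n} (h : i.1 + 1 < j.1 ∨ j.1 + 1 < i.1) :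
    simpleT i (idxLow j) = idxLow j :=
  Equiv.swap_apply_of_ne_of_ne (by simp [idxLow]; omega) (by simp [idxLow, idxHigh]; omega)

theorem simpleT_idxHigh_of_far {i j : Idx n} (h : i.1 + 1 < j.1 ∨ j.1 + 1 < i.1) :
    simpleT i (idxHigh j) = idxHigh j :=
  Equiv.swap_apply_of_ne_of_ne (by simp [idxLow, idxHigh]; omega) (by simp [idxHigh]; omega)

theorem idxHigh_eq_idxLow {i j : Idx n} (h : i.1 + 1 = j.1) : idxHigh i = idxLow j := by
  simp [idxLow, idxHigh, h]

theorem simpleT_idxHigh_of_succ {i j : Idx n} (h : i.1 + 1 = j.1) :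
    simpleT i (idxHigh j) = idxHigh j :=
  Equiv.swap_apply_of_ne_of_ne (by simp [idxLow, idxHigh]; omega) (by simp [idxHigh]; omega)

theorem simpleT_idxLow_of_succ {i j : Idx n} (h : i.1 + 1 = j.1) :
    simpleT j (idxLow i) = idxLow i :=
  Equiv.swap_apply_of_ne_of_ne (by simp [idxLow]; omega) (by simp [idxLow, idxHigh]; omega)

theorem simpleT_commute {i j : Idx n} (h : i.1 + 1 < j.1 ∨ j.1 + 1 < i.1) :
    simpleT i * simpleT j = simpleT j * simpleT i := by
  conv_lhs => rw [simpleT.eq_def j, Equiv.mul_swap_eq_swap_mul, simpleT_idxLow_of_far h,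
    simpleT_idxHigh_of_far h]
  rfl

theorem simpleT_braid {i j : Idx n} (h : i.1 + 1 = j.1) :
    simpleT i * simpleT j * simpleT i = simpleT j * simpleT i * simpleT j := by
  have hi : simpleT i * simpleT j = Equiv.swap (idxLow i) (idxHigh j) * simpleT i := by
    conv_lhs => rw [simpleT.eq_def j, Equiv.mul_swap_eq_swap_mul, ← idxHigh_eq_idxLow h,
      simpleT_idxHigh, simpleT_idxHigh_of_succ h]
  have hj : simpleT j * simpleT i = Equiv.swap (idxLow i) (idxHigh j) * simpleT j := by
    conv_lhs => rw [simpleT.eq_def i, Equiv.mul_swap_eq_swap_mul, idxHigh_eq_idxLow h,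
      simpleT_idxLow, simpleT_idxLow_of_succ h]
  rw [hi, hj, mul_assoc, mul_assoc, simpleT_mul_self, simpleT_mul_self]

theorem eq_of_simpleT_inverts {j : Idx n} {a b : Fin n} (hab : a < b)
    (h : ¬ simpleT j a < simpleT j b) : a = idxLow j ∧ b = idxHigh j := by
  simp only [simpleT, Equiv.swap_apply_def, idxLow, idxHigh, Fin.ext_iff, Fin.lt_def] at *
  split_ifs at h <;> simp at * <;> omega

theorem wordProd_cons (i : Idx n) (w : List (Idx n)) :
    wordProd (i :: w) = simpleT i * wordProd w := by
  simp [wordProd]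

/-- The strong exchange property, for words that need not be reduced. -/
theorem exists_word_swap_mul (w : List (Idx n)) {a b : Fin n} (hab : a < b)
    (h : (wordProd w)⁻¹ b < (wordProd w)⁻¹ a) :
    ∃ w' : List (Idx n), w'.length + 1 = w.length ∧
      wordProd w' = Equiv.swap a b * wordProd w := by
  induction w generalizing a b with
  | nil => simp [wordProd] at h; exact absurd hab h.not_gt
  | cons j w ih =>
    by_cases hj : simpleT j a < simpleT j b
    · have h' : (wordProd w)⁻¹ (simpleT j b) < (wordProd w)⁻¹ (simpleT j a) := by
        simpa [wordProd_cons, mul_inv_rev, simpleT_inv] using h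
      obtain ⟨w', hl, hp⟩ := ih hj h'
      refine ⟨j :: w', by simp [hl], ?_⟩
      rw [wordProd_cons, wordProd_cons, hp, ← mul_assoc, Equiv.mul_swap_eq_swap_mul,
        ← mul_assoc]
      simp only [← Equiv.Perm.mul_apply, simpleT_mul_self, Equiv.Perm.one_apply]
    · obtain ⟨rfl, rfl⟩ := eq_of_simpleT_inverts hab hj
      refine ⟨w, by simp, ?_⟩
      rw [wordProd_cons, ← mul_assoc, ← simpleT.eq_def, simpleT_mul_self, one_mul]

theorem exists_word_simpleT_mul {w : List (Idx n)} {σ : Equiv.Perm (Fin n)} {i : Idx n}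
    (hw : wordProd w = σ) (h : σ⁻¹ (idxHigh i) < σ⁻¹ (idxLow i)) :
    ∃ w' : List (Idx n), w'.length + 1 = w.length ∧ wordProd w' = simpleT i * σ := by
  subst hw
  exact exists_word_swap_mul w (idxLow_lt_idxHigh i) h

theorem IsReducedWord.tail {i : Idx n} {w : List (Idx n)} {σ : Equiv.Perm (Fin n)}
    (h : IsReducedWord (i :: w) σ) : IsReducedWord w (simpleT i * σ) := by
  refine ⟨?_, fun w' hw' => ?_⟩
  · rw [← h.1, wordProd_cons, ← mul_assoc, simpleT_mul_self, one_mul]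
  · have := h.2 (i :: w') (by rw [wordProd_cons, hw', ← mul_assoc, simpleT_mul_self, one_mul])
    simpa using this

theorem IsReducedWord.of_length_eq {u v : List (Idx n)} {σ : Equiv.Perm (Fin n)}
    (hu : IsReducedWord u σ) (hv : wordProd v = σ) (hl : v.length = u.length) :
    IsReducedWord v σ :=
  ⟨hv, fun w' hw' => hl ▸ hu.2 w' hw'⟩

theorem IsReducedWord.length_eq {u v : List (Idx n)} {σ : Equiv.Perm (Fin n)}
    (hu : IsReducedWord u σ) (hv : IsReducedWord v σ) : u.length = v.length :=
  le_antisymm (hu.2 v hv.1) (hv.2 u hu.1)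

theorem IsReducedWord.len_eq {w : List (Idx n)} {σ : Equiv.Perm (Fin n)}
    (h : IsReducedWord w σ) : len σ = w.length := by
  refine le_antisymm (Nat.sInf_le ⟨w, h.1, rfl⟩) (le_csInf ⟨_, w, h.1, rfl⟩ ?_)
  rintro _ ⟨w', hw', rfl⟩
  exact h.2 w' hw'

theorem len_le_length (w : List (Idx n)) : len (wordProd w) ≤ w.length :=
  Nat.sInf_le ⟨w, rfl, rfl⟩

theorem exists_length_eq_len (w : List (Idx n)) :
    ∃ w' : List (Idx n), wordProd w' = wordProd w ∧ w'.length = len (wordProd w) :=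
  Nat.sInf_mem (s := {k | ∃ w' : List (Idx n), wordProd w' = wordProd w ∧ w'.length = k})
    ⟨_, w, rfl, rfl⟩

theorem IsReducedWord.inverts_head {i : Idx n} {w : List (Idx n)} {σ : Equiv.Perm (Fin n)}
    (h : IsReducedWord (i :: w) σ) : σ⁻¹ (idxHigh i) < σ⁻¹ (idxLow i) := by
  by_contra hlt
  have hlt' := lt_of_le_of_ne (not_lt.mp hlt)
    (fun he => (idxLow_lt_idxHigh i).ne (σ⁻¹.injective he))
  obtain ⟨w', hl, hp⟩ := exists_word_simpleT_mul (i := i) h.tail.1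
    (by simpa [mul_inv_rev, simpleT_inv, simpleT_idxLow, simpleT_idxHigh] using hlt')
  rw [← mul_assoc, simpleT_mul_self, one_mul] at hp
  have := h.2 w' hp
  simp at this
  omega

end SimpleTranspositions

section Theta

variable {n : ℕ} {D : DD n}

theorem X_sub_X_ne_zero {a b : Fin n} (h : a ≠ b) :
    (X a - X b : MvPolynomial (Fin n) ℤ) ≠ 0 :=
  sub_ne_zero.mpr fun he => h (X_injective he)

theorem IsDividedDiff.thetaOp_spec (hD : IsDividedDiff D) (i : Idx n)
    (f : MvPolynomial (Fin n) ℤ) :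
    (X (idxLow i) - X (idxHigh i)) * thetaOp D i f
      = X (idxHigh i) * (f - (rename (simpleT i)).toRingHom f) := by
  have h := hD i f
  simp only [sOp] at h
  simp only [thetaOp, AlgHom.toRingHom_eq_coe, RingHom.coe_coe]
  linear_combination X (idxHigh i) * h

theorem rename_simpleT_rename_simpleT (i : Idx n) (f : MvPolynomial (Fin n) ℤ) :
    rename (simpleT i) (rename (simpleT i) f) = f := by
  rw [rename_rename, ← Equiv.Perm.coe_mul, simpleT_mul_self, Equiv.Perm.coe_one, rename_id_apply]

theorem IsDividedDiff.thetaOp_thetaOp (hD : IsDividedDiff D) (i : Idx n)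
    (f : MvPolynomial (Fin n) ℤ) : thetaOp D i (thetaOp D i f) = - thetaOp D i f :=
  demazure_quadratic (X_sub_X_ne_zero (idxLow_lt_idxHigh i).ne)
    (by simp [simpleT_idxLow]) (by simp [simpleT_idxHigh])
    (by simpa using rename_simpleT_rename_simpleT i) (hD.thetaOp_spec i) f

theorem IsDividedDiff.thetaOp_commute (hD : IsDividedDiff D) {i j : Idx n}
    (h : i.1 + 1 < j.1 ∨ j.1 + 1 < i.1) (f : MvPolynomial (Fin n) ℤ) :
    thetaOp D i (thetaOp D j f) = thetaOp D j (thetaOp D i f) :=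
  demazure_commute (X_sub_X_ne_zero (idxLow_lt_idxHigh i).ne)
    (X_sub_X_ne_zero (idxLow_lt_idxHigh j).ne)
    (by simp [simpleT_idxLow_of_far h]) (by simp [simpleT_idxHigh_of_far h])
    (by simp [simpleT_idxLow_of_far h.symm]) (by simp [simpleT_idxHigh_of_far h.symm])
    (fun f => by
      simp only [AlgHom.toRingHom_eq_coe, RingHom.coe_coe, rename_rename, ← Equiv.Perm.coe_mul,
        simpleT_commute h])
    (hD.thetaOp_spec i) (hD.thetaOp_spec j) f

theorem IsDividedDiff.thetaOp_braid (hD : IsDividedDiff D) {i j : Idx n}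
    (h : i.1 + 1 = j.1) (f : MvPolynomial (Fin n) ℤ) :
    thetaOp D i (thetaOp D j (thetaOp D i f)) = thetaOp D j (thetaOp D i (thetaOp D j f)) := by
  have hlow := idxHigh_eq_idxLow h
  have hij := idxLow_lt_idxHigh i
  have hjj := idxLow_lt_idxHigh j
  rw [← hlow] at hjj
  have hS := hD.thetaOp_spec i
  have hT := hD.thetaOp_spec j
  have hss := rename_simpleT_rename_simpleT i
  have htt := rename_simpleT_rename_simpleT j
  have hst (g : MvPolynomial (Fin n) ℤ) : rename (simpleT i) (rename (simpleT j)
      (rename (simpleT i) g)) = rename (simpleT j) (rename (simpleT i) (rename (simpleT j) g)) := by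
    simp only [rename_rename, ← Equiv.Perm.coe_mul, ← mul_assoc, simpleT_braid h]
  have htb : rename (simpleT j) (X (idxHigh i) : MvPolynomial (Fin n) ℤ) = X (idxHigh j) := by
    rw [rename_X, hlow, simpleT_idxLow]
  have htc : rename (simpleT j) (X (idxHigh j) : MvPolynomial (Fin n) ℤ) = X (idxHigh i) := by
    rw [rename_X, hlow, simpleT_idxHigh]
  rw [← hlow] at hT
  refine demazure_braid (s := (rename (simpleT i)).toRingHom)
    (t := (rename (simpleT j)).toRingHom) (X_sub_X_ne_zero hij.ne)
    (X_sub_X_ne_zero hjj.ne) (X_sub_X_ne_zero (hij.trans hjj).ne)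
    (by simp [simpleT_idxLow]) (by simp [simpleT_idxHigh])
    (by simp [simpleT_idxHigh_of_succ h]) (by simp [simpleT_idxLow_of_succ h])
    htb htc hss htt hst ?_ ?_ f
  · exact hS
  · exact hT

/-- The inductive step of Matsumoto's theorem for commuting first letters. -/
theorem thetaWord_cons_eq_cons_of_far (hD : IsDividedDiff D) {i j : Idx n}
    {u v : List (Idx n)} {σ : Equiv.Perm (Fin n)}
    (ih : ∀ {u' v' : List (Idx n)} {τ : Equiv.Perm (Fin n)}, u'.length = u.length →
      IsReducedWord u' τ → IsReducedWord v' τ → thetaWord D u' = thetaWord D v')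
    (hu : IsReducedWord (i :: u) σ) (hv : IsReducedWord (j :: v) σ)
    (h : i.1 + 1 < j.1 ∨ j.1 + 1 < i.1) :
    thetaWord D (i :: u) = thetaWord D (j :: v) := by
  have hl : u.length = v.length := by simpa using hu.length_eq hv
  obtain ⟨x, hxl, hx⟩ := exists_word_simpleT_mul (i := j) hu.tail.1 (by
    simpa [mul_inv_rev, simpleT_inv, simpleT_idxLow_of_far h, simpleT_idxHigh_of_far h]
      using hv.inverts_head)
  have hjx : wordProd (j :: x) = simpleT i * σ := by
    rw [wordProd_cons, hx, ← mul_assoc, simpleT_mul_self, one_mul]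
  have hix : wordProd (i :: x) = simpleT j * σ := by
    rw [wordProd_cons, hx, ← mul_assoc, ← mul_assoc, simpleT_commute h, mul_assoc (simpleT j),
      simpleT_mul_self, mul_one]
  have e1 := ih rfl hu.tail (hu.tail.of_length_eq hjx (by simpa using hxl))
  have e2 := ih hl.symm hv.tail (hv.tail.of_length_eq hix (by simp; omega))
  funext f
  simp only [thetaWord, e1, e2]
  exact hD.thetaOp_commute h _

/-- The inductive step of Matsumoto's theorem for adjacent first letters. -/
theorem thetaWord_cons_eq_cons_of_succ (hD : IsDividedDiff D) {i j : Idx n}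
    {u v : List (Idx n)} {σ : Equiv.Perm (Fin n)}
    (ih : ∀ {u' v' : List (Idx n)} {τ : Equiv.Perm (Fin n)}, u'.length = u.length →
      IsReducedWord u' τ → IsReducedWord v' τ → thetaWord D u' = thetaWord D v')
    (hu : IsReducedWord (i :: u) σ) (hv : IsReducedWord (j :: v) σ) (h : i.1 + 1 = j.1) :
    thetaWord D (i :: u) = thetaWord D (j :: v) := by
  have hl : u.length = v.length := by simpa using hu.length_eq hv
  have hlow := idxHigh_eq_idxLow h
  have hi := hu.inverts_head
  have hj := hv.inverts_head
  obtain ⟨y, hyl, hy⟩ := exists_word_simpleT_mul (i := j) hu.tail.1 (by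
    rw [← hlow] at hj ⊢
    simpa [mul_inv_rev, simpleT_inv, simpleT_idxHigh, simpleT_idxHigh_of_succ h]
      using hj.trans hi)
  obtain ⟨x, hxl, hx⟩ := exists_word_simpleT_mul (i := i) hy (by
    simpa [mul_inv_rev, simpleT_inv, simpleT_idxLow_of_succ h, simpleT_idxLow, hlow,
      simpleT_idxHigh_of_succ h] using hj)
  have hjx : wordProd (j :: i :: x) = simpleT i * σ := by
    rw [wordProd_cons, wordProd_cons, hx, ← mul_assoc (simpleT i), simpleT_mul_self, one_mul,
      ← mul_assoc, simpleT_mul_self, one_mul]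
  have hix : wordProd (i :: j :: x) = simpleT j * σ := by
    have hx' : wordProd x = simpleT j * (simpleT i * (simpleT j * σ)) := by
      rw [hx]
      simp only [← mul_assoc, simpleT_braid h]
    rw [wordProd_cons, wordProd_cons, hx', ← mul_assoc (simpleT j), simpleT_mul_self, one_mul,
      ← mul_assoc, simpleT_mul_self, one_mul]
  have e1 := ih rfl hu.tail (hu.tail.of_length_eq hjx (by simp; omega))
  have e2 := ih hl.symm hv.tail (hv.tail.of_length_eq hix (by simp; omega))
  funext f
  simp only [thetaWord, e1, e2]
  exact hD.thetaOp_braid h _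

/-- Reduced words of the same permutation give the same operator `θ`. -/
theorem IsDividedDiff.thetaWord_eq (hD : IsDividedDiff D) {u v : List (Idx n)}
    {σ : Equiv.Perm (Fin n)} (hu : IsReducedWord u σ) (hv : IsReducedWord v σ) :
    thetaWord D u = thetaWord D v := by
  induction hk : u.length generalizing u v σ with
  | zero =>
    have hl := hu.length_eq hv
    rw [hk] at hl
    rw [List.length_eq_zero_iff.mp hk, List.length_eq_zero_iff.mp hl.symm]
  | succ k ih =>
    have hl := hu.length_eq hv
    match u, v, hk, hl with
    | i :: u, j :: v, hk, hl =>
      have hku : u.length = k := by simpa using hk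
      have hkv : v.length = k := by simp at hl; omega
      rcases lt_trichotomy i.1 j.1 with hij | hij | hij
      · rcases (Nat.succ_le_of_lt hij).lt_or_eq with h | h
        · exact thetaWord_cons_eq_cons_of_far hD
            (fun h1 h2 h3 => ih h2 h3 (h1.trans hku)) hu hv (Or.inl h)
        · exact thetaWord_cons_eq_cons_of_succ hD
            (fun h1 h2 h3 => ih h2 h3 (h1.trans hku)) hu hv h
      · obtain rfl := Subtype.ext hij
        funext f
        simp only [thetaWord, ih hu.tail hv.tail hku]
      · rcases (Nat.succ_le_of_lt hij).lt_or_eq with h | h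
        · exact thetaWord_cons_eq_cons_of_far hD
            (fun h1 h2 h3 => ih h2 h3 (h1.trans hku)) hu hv (Or.inr h)
        · exact (thetaWord_cons_eq_cons_of_succ hD
            (fun h1 h2 h3 => ih h2 h3 (h1.trans hkv)) hv hu h).symm

end Theta

/-- `θ_i θ_γ = -θ_γ` if `l(s_iγ) = l(γ) - 1`, and `(i, i_1, …, i_k)` is a
reduced word for `s_iγ` if `l(s_iγ) = l(γ) + 1`. -/
theorem stmt6 (n : ℕ) (D : DD n) (hD : IsDividedDiff D)
    (γ : Equiv.Perm (Fin n)) (w : List (Idx n)) (hw : IsReducedWord w γ) (i : Idx n) :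
    (len (simpleT i * γ) = len γ - 1 →
      ∀ f : MvPolynomial (Fin n) ℤ, thetaOp D i (thetaWord D w f) = - thetaWord D w f) ∧
    (len (simpleT i * γ) = len γ + 1 → IsReducedWord (i :: w) (simpleT i * γ)) := by
  have hiw : wordProd (i :: w) = simpleT i * γ := by rw [wordProd_cons, hw.1]
  have hlen := hw.len_eq
  refine ⟨fun h f => ?_, fun h => ⟨hiw, fun w' hw' => ?_⟩⟩
  · obtain ⟨x, hx, hxl⟩ := exists_length_eq_len (i :: w)
    rw [hiw] at hx hxl
    have hix : wordProd (i :: x) = γ := by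
      rw [wordProd_cons, hx, ← mul_assoc, simpleT_mul_self, one_mul]
    have hpos : w.length ≠ 0 := fun h0 => by
      have hγ : γ = 1 := by rw [← hw.1, List.length_eq_zero_iff.mp h0]; rfl
      have hx0 : x = [] := List.length_eq_zero_iff.mp (by omega)
      rw [hx0, hγ, mul_one] at hx
      have hfix := congrArg (fun σ : Equiv.Perm (Fin n) => σ (idxLow i)) hx
      exact (idxLow_lt_idxHigh i).ne (hfix.trans (simpleT_idxLow i))
    rw [hD.thetaWord_eq hw (hw.of_length_eq hix (by simp; omega))]
    exact hD.thetaOp_thetaOp i _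
  · have := len_le_length w'
    rw [hw'] at this
    simp
    omega
end
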